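/- (Conformal null case, T(Z) spans g₋₁.) Let Z ∈ (ℝⁿ)* be a nonzero row covector with ⟨Z,Z⟩ = 0 (this forces the signature to be indefinite). Then the set T(Z) = {X ∈ ℝⁿ : Z⬝X = 1 and ⟨X,X⟩ = 0} spans ℝⁿ as a real vector space. -/

import Mathlib

open Matrix

/-- Index type for (n+2)×(n+2) block matrices with blocks of sizes 1, n, 1. -/
abbrev Idx (n : ℕ) := Unit ⊕ Fin n ⊕ Unit

/-- The diagonal entries of the signature matrix I = diag(Id_p, −Id_q). -/
def sig (p q : ℕ) : Fin (p + q) → ℝ := fun i => if (i : ℕ) < p then 1 else -1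

/-- The n×n signature matrix I = diag(Id_p, −Id_q). -/
def sigMat (p q : ℕ) : Matrix (Fin (p + q)) (Fin (p + q)) ℝ := Matrix.diagonal (sig p q)

/-- The inner product of signature (p,q): ⟨X,Y⟩ = Xᵀ I Y (the same formula gives
Z I Wᵀ for row covectors). -/
def form (p q : ℕ) (X Y : Fin (p + q) → ℝ) : ℝ := ∑ i, X i * sig p q i * Y i

/-- The column vector I Zᵀ associated to a row covector Z (written `starr`) (equally, the row covector
Xᵀ I associated to a column vector X). -/
def iFlip (p q : ℕ) (Z : Fin (p + q) → ℝ) : Fin (p + q) → ℝ := fun i => sig p q i * Z i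

/-- Embedding of g₋₁ ≅ ℝⁿ into so(p+1,q+1): (2,1)-block X, (3,2)-block −XᵀI. -/
def iotaMinus (p q : ℕ) (X : Fin (p + q) → ℝ) : Matrix (Idx (p + q)) (Idx (p + q)) ℝ :=
  Matrix.of fun i j =>
    match i, j with
    | Sum.inr (Sum.inl i), Sum.inl _ => X i
    | Sum.inr (Sum.inr _), Sum.inr (Sum.inl j) => -(X j * sig p q j)
    | _, _ => 0

/-- Embedding of g₁ ≅ (ℝⁿ)* into so(p+1,q+1): (1,2)-block Z, (2,3)-block −IZᵀ. -/
def iotaPlus (p q : ℕ) (Z : Fin (p + q) → ℝ) : Matrix (Idx (p + q)) (Idx (p + q)) ℝ :=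
  Matrix.of fun i j =>
    match i, j with
    | Sum.inl _, Sum.inr (Sum.inl j) => Z j
    | Sum.inr (Sum.inl i), Sum.inr (Sum.inr _) => -(sig p q i * Z i)
    | _, _ => 0

/-- Embedding of g₀ into so(p+1,q+1): block diagonal matrix diag(a, A, −a). -/
def iotaZero (p q : ℕ) (A : Matrix (Fin (p + q)) (Fin (p + q)) ℝ) (a : ℝ) :
    Matrix (Idx (p + q)) (Idx (p + q)) ℝ :=
  Matrix.of fun i j =>
    match i, j with
    | Sum.inl _, Sum.inl _ => a
    | Sum.inr (Sum.inl i), Sum.inr (Sum.inl j) => A i j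
    | Sum.inr (Sum.inr _), Sum.inr (Sum.inr _) => -a
    | _, _ => 0

lemma form_add_smul_self (p q : ℕ) (t : ℝ) (X Y : Fin (p + q) → ℝ) :
    form p q (X + t • Y) (X + t • Y) =
      form p q X X + 2 * t * form p q X Y + t ^ 2 * form p q Y Y := by
  simp only [form, Pi.add_apply, Pi.smul_apply, smul_eq_mul, Finset.mul_sum,
    ← Finset.sum_add_distrib]
  exact Finset.sum_congr rfl fun _ _ => by ring

lemma sig_mul_self (p q : ℕ) (i : Fin (p + q)) : sig p q i * sig p q i = 1 := by
  unfold sig; split_ifs <;> norm_num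

lemma form_iFlip_right (p q : ℕ) (X Z : Fin (p + q) → ℝ) :
    form p q X (iFlip p q Z) = ∑ i, Z i * X i :=
  Finset.sum_congr rfl fun i _ => by
    unfold iFlip
    linear_combination X i * Z i * sig_mul_self p q i

lemma sum_mul_iFlip (p q : ℕ) (Z : Fin (p + q) → ℝ) :
    ∑ i, Z i * iFlip p q Z i = form p q Z Z :=
  Finset.sum_congr rfl fun i _ => by unfold iFlip; ring

lemma exists_ne_sig_eq (p q : ℕ) (hn : 3 ≤ p + q) :
    ∃ i j : Fin (p + q), i ≠ j ∧ sig p q i = sig p q j := by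
  by_cases hp : 2 ≤ p
  · refine ⟨⟨0, by omega⟩, ⟨1, by omega⟩, by simp, ?_⟩
    simp [sig, show 0 < p by omega, show 1 < p by omega]
  · refine ⟨⟨1, by omega⟩, ⟨2, by omega⟩, by simp, ?_⟩
    simp [sig, show ¬ 1 < p by omega, show ¬ 2 < p by omega]

/-- In dimension at least three, no hyperplane is totally isotropic. -/
lemma exists_form_self_ne_zero_of_ker (p q : ℕ) (hn : 3 ≤ p + q) (Z : Fin (p + q) → ℝ) :
    ∃ Y : Fin (p + q) → ℝ, ∑ i, Z i * Y i = 0 ∧ form p q Y Y ≠ 0 := by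
  obtain ⟨i, j, hij, hs⟩ := exists_ne_sig_eq p q hn
  have hsi : sig p q i ≠ 0 := left_ne_zero_of_mul_eq_one (sig_mul_self p q i)
  by_cases hi : Z i = 0
  · refine ⟨Pi.single i 1, by simp [Pi.single_apply, hi], ?_⟩
    simpa [form, Pi.single_apply] using hsi
  · refine ⟨Pi.single i (Z j) + (-Z i) • Pi.single j 1, ?_, ?_⟩
    · simp [Pi.single_apply, mul_add, Finset.sum_add_distrib]
      ring
    · have h : form p q (Pi.single i (Z j) + (-Z i) • Pi.single j 1)
          (Pi.single i (Z j) + (-Z i) • Pi.single j 1) =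
          sig p q i * (Z j ^ 2 + Z i ^ 2) := by
        rw [form_add_smul_self]
        simp [form, Pi.single_apply, hij.symm, ← hs]
        ring
      rw [h]
      have : 0 < Z i ^ 2 := by positivity
      exact mul_ne_zero hsi (by positivity)

/-- Conformal null case, T(Z) spans g₋₁: for Z ≠ 0 with ⟨Z,Z⟩ = 0,
the set T(Z) = {X : Z⬝X = 1 and ⟨X,X⟩ = 0} spans ℝⁿ. -/
theorem conformal_null_TZ_spans (p q : ℕ) (hn : 3 ≤ p + q) (Z : Fin (p + q) → ℝ)
    (hZ : Z ≠ 0) (hnull : form p q Z Z = 0) :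
    Submodule.span ℝ {X : Fin (p + q) → ℝ | (∑ i, Z i * X i) = 1 ∧ form p q X X = 0} = ⊤ := by
  set S := Submodule.span ℝ
    {X : Fin (p + q) → ℝ | (∑ i, Z i * X i) = 1 ∧ form p q X X = 0} with hS
  set W := iFlip p q Z with hW
  have dot_add (X Y : Fin (p + q) → ℝ) (t : ℝ) :
      ∑ i, Z i * (X + t • Y) i = ∑ i, Z i * X i + t * ∑ i, Z i * Y i := by
    simp only [Pi.add_apply, Pi.smul_apply, smul_eq_mul, Finset.mul_sum,
      ← Finset.sum_add_distrib]
    exact Finset.sum_congr rfl fun _ _ => by ring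
  have hZW : ∑ i, Z i * W i = 0 := by rw [hW, sum_mul_iFlip, hnull]
  have hWW : form p q W W = 0 := by rw [hW, form_iFlip_right, ← hW, hZW]
  -- Every vector of the affine hyperplane is moved into the null cone along `W`.
  have mem_add (X : Fin (p + q) → ℝ) (hX : ∑ i, Z i * X i = 1) :
      X + (-(form p q X X / 2)) • W ∈ S := by
    refine Submodule.subset_span ⟨?_, ?_⟩
    · rw [dot_add, hX, hZW]; ring
    · rw [form_add_smul_self, hWW, hW, form_iFlip_right, hX]; ring
  obtain ⟨X₀, hX₀⟩ : ∃ X : Fin (p + q) → ℝ, ∑ i, Z i * X i = 1 := by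
    obtain ⟨i, hi⟩ := Function.ne_iff.mp hZ
    exact ⟨Pi.single i (Z i)⁻¹, by simpa [Pi.single_apply] using mul_inv_cancel₀ hi⟩
  obtain ⟨Y, hY, hYY⟩ := exists_form_self_ne_zero_of_ker p q hn Z
  have hWS : W ∈ S := by
    have h1 := mem_add (X₀ + (1 : ℝ) • Y) (by rw [dot_add, hX₀, hY]; ring)
    have h2 := mem_add (X₀ + (-1 : ℝ) • Y) (by rw [dot_add, hX₀, hY]; ring)
    have h3 := S.sub_mem (S.add_mem h1 h2) (S.smul_mem 2 (mem_add X₀ hX₀))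
    rw [form_add_smul_self, form_add_smul_self] at h3
    have h4 := S.smul_mem (-(form p q Y Y)⁻¹) h3
    convert h4 using 1
    ext i
    simp only [Pi.add_apply, Pi.sub_apply, Pi.smul_apply, smul_eq_mul]
    field_simp
    ring
  have mem_of_dot_eq_one (X : Fin (p + q) → ℝ) (hX : ∑ i, Z i * X i = 1) : X ∈ S :=
    (S.add_mem_iff_left (S.smul_mem _ hWS)).mp (mem_add X hX)
  refine Submodule.eq_top_iff'.mpr fun V => ?_
  refine (S.add_mem_iff_left (S.smul_mem (1 - ∑ i, Z i * V i)
    (mem_of_dot_eq_one X₀ hX₀))).mp (mem_of_dot_eq_one _ ?_)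
  rw [dot_add, hX₀]
  ring
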